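/- Let ‖·‖ be a 1-unconditional norm on ℝⁿ, write f(x) = ‖x‖, and suppose the isotropic condition of the minimal-M position holds: ∫ ∂ᵢ f(x) · xᵢ dγₙ(x) = E‖G‖ / n for every i = 1, …, n. Then for every i = 1, …, n, ∫ |∂ᵢ f(x)| dγₙ(x) ≤ √(π/2) · E‖G‖ / n, where G is a standard n-dimensional Gaussian vector. -/

import Mathlib

open MeasureTheory ProbabilityTheory Real

/-- The standard Gaussian measure `γₙ` on `ℝⁿ`. -/
noncomputable def stdGaussian (n : ℕ) : Measure (Fin n → ℝ) :=
  Measure.pi fun _ => gaussianReal 0 1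

/-- The `i`-th partial derivative of `f : ℝⁿ → ℝ` (via the Fréchet derivative;
for a norm it exists and agrees with the usual partial derivative `γₙ`-a.e.). -/
noncomputable def partialDeriv {n : ℕ} (f : (Fin n → ℝ) → ℝ) (i : Fin n)
    (x : Fin n → ℝ) : ℝ :=
  fderiv ℝ f x (Pi.single i 1)

theorem ConvexOn.add_mul_sub_le_of_hasDerivAt {φ : ℝ → ℝ} {a s : ℝ}
    (hφ : ConvexOn ℝ Set.univ φ) (ha : HasDerivAt φ a s) (u : ℝ) :
    φ s + a * (u - s) ≤ φ u := by
  rcases lt_trichotomy s u with h | rfl | h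
  · have := hφ.le_slope_of_hasDerivAt (Set.mem_univ _) (Set.mem_univ _) h ha
    rw [slope_def_field, le_div_iff₀ (sub_pos.2 h)] at this
    linarith
  · simp
  · have := hφ.slope_le_of_hasDerivAt (Set.mem_univ _) (Set.mem_univ _) h ha
    rw [slope_def_field, div_le_iff₀ (sub_pos.2 h)] at this
    linarith

theorem ConvexOn.deriv_mul_self_nonneg_of_even {φ : ℝ → ℝ} {a s : ℝ}
    (hφ : ConvexOn ℝ Set.univ φ) (heven : ∀ u, φ (-u) = φ u) (ha : HasDerivAt φ a s) :
    0 ≤ a * s := by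
  have := hφ.add_mul_sub_le_of_hasDerivAt ha (-s)
  rw [heven] at this
  linarith

/-- The absolute value of the derivative of an even convex function is nondecreasing in the
absolute value of the argument. -/
theorem ConvexOn.abs_deriv_le_of_even {φ : ℝ → ℝ} {a b s t : ℝ}
    (hφ : ConvexOn ℝ Set.univ φ) (heven : ∀ u, φ (-u) = φ u)
    (ha : HasDerivAt φ a s) (hb : HasDerivAt φ b t) (hts : |t| < |s|) : |b| ≤ |a| := by
  have h1 := hφ.add_mul_sub_le_of_hasDerivAt ha t
  have h2 := hφ.add_mul_sub_le_of_hasDerivAt hb s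
  have h3 := hφ.add_mul_sub_le_of_hasDerivAt ha (-t)
  have h4 := hφ.add_mul_sub_le_of_hasDerivAt hb (-s)
  rw [heven] at h3 h4
  rcases le_total 0 s with hs | hs
  · rw [abs_of_nonneg hs, abs_lt] at hts
    refine (abs_le.2 ⟨?_, ?_⟩).trans (le_abs_self a)
    · have : 0 ≤ (a + b) * (s + t) := by linarith
      linarith [nonneg_of_mul_nonneg_left this (by linarith)]
    · have : 0 ≤ (a - b) * (s - t) := by linarith
      linarith [nonneg_of_mul_nonneg_left this (by linarith)]
  · rw [abs_of_nonpos hs, abs_lt] at hts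
    refine (abs_le.2 ⟨?_, ?_⟩).trans (neg_le_abs a)
    · have : 0 ≤ (b - a) * (t - s) := by linarith
      linarith [nonneg_of_mul_nonneg_left this (by linarith)]
    · have : 0 ≤ (-a - b) * (-s - t) := by linarith
      linarith [nonneg_of_mul_nonneg_left this (by linarith)]

/-- Chebyshev's association inequality on a probability space. -/
theorem integral_mul_integral_le_of_ae_monovary {α : Type*} [MeasurableSpace α] {μ : Measure α}
    [IsProbabilityMeasure μ] {g h : α → ℝ} (hg : Integrable g μ) (hh : Integrable h μ)
    (hgh : Integrable (fun x => g x * h x) μ)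
    (hmono : ∀ᵐ s ∂μ, ∀ᵐ t ∂μ, 0 ≤ (g s - g t) * (h s - h t)) :
    (∫ x, g x ∂μ) * ∫ x, h x ∂μ ≤ ∫ x, g x * h x ∂μ := by
  have inner (s : α) : ∫ t, (g s - g t) * (h s - h t) ∂μ
      = g s * h s - g s * (∫ x, h x ∂μ) - (∫ x, g x ∂μ) * h s + ∫ x, g x * h x ∂μ := by
    have hexp : (fun t => (g s - g t) * (h s - h t))
        = fun t => g s * h s - g s * h t - g t * h s + g t * h t := by
      ext t; ring
    rw [hexp, integral_add (by fun_prop) hgh, integral_sub (by fun_prop) (by fun_prop),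
      integral_sub (by fun_prop) (by fun_prop), integral_const_mul, integral_mul_const]
    simp [integral_const_mul]
  have key : 0 ≤ ∫ s, ∫ t, (g s - g t) * (h s - h t) ∂μ ∂μ :=
    integral_nonneg_of_ae (hmono.mono fun s hs => integral_nonneg_of_ae hs)
  simp_rw [inner] at key
  rw [integral_add (by fun_prop) (by fun_prop), integral_sub (by fun_prop) (by fun_prop),
    integral_sub hgh (by fun_prop), integral_mul_const, integral_const_mul] at key
  simp at key
  linarith

theorem integrable_abs_gaussianReal : Integrable (fun x : ℝ => |x|) (gaussianReal 0 1) :=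
  ((memLp_id_gaussianReal 1).integrable (by simp)).abs

theorem integral_abs_gaussianReal : ∫ x, |x| ∂gaussianReal 0 1 = √(2 / π) := by
  rw [integral_gaussianReal_eq_integral_smul one_ne_zero]
  have heq : (fun x : ℝ => gaussianPDFReal 0 1 x • |x|)
      = fun x : ℝ => (fun y : ℝ => (√(2 * π))⁻¹ * (y * rexp (-y ^ 2 / 2))) |x| := by
    ext x
    simp [gaussianPDFReal]
    ring
  have hint : ∫ x in Set.Ioi (0 : ℝ), x * rexp (-x ^ 2 / 2) = 1 := by
    have := integral_rpow_mul_exp_neg_mul_rpow (p := 2) (q := 1) (b := 1 / 2)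
      (by norm_num) (by norm_num) (by norm_num)
    norm_num at this
    rw [← this]
    congr 1 with x
    congr 2
    ring
  rw [heq, integral_comp_abs (f := fun y : ℝ => (√(2 * π))⁻¹ * (y * rexp (-y ^ 2 / 2))), integral_const_mul, hint, Real.sqrt_mul (by norm_num),
    Real.sqrt_div (by norm_num)]
  have h2 : √(2 : ℝ) * √2 = 2 := Real.mul_self_sqrt (by norm_num)
  have hπ : √π ≠ 0 := by positivity
  field_simp
  nlinarith

instance (n : ℕ) : IsProbabilityMeasure (_root_.stdGaussian n) := by
  unfold _root_.stdGaussian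
  infer_instance

theorem measurePreserving_insertNth_stdGaussian {m : ℕ} (i : Fin (m + 1)) :
    MeasurePreserving (MeasurableEquiv.piFinSuccAbove (fun _ => ℝ) i).symm
      ((gaussianReal 0 1).prod (stdGaussian m)) (stdGaussian (m + 1)) :=
  (measurePreserving_piFinSuccAbove (fun _ => gaussianReal 0 1) i).symm

theorem stdGaussian_absolutelyContinuous (n : ℕ) : stdGaussian n ≪ volume := by
  induction n with
  | zero => rw [_root_.stdGaussian, volume_pi, Measure.pi_of_empty, Measure.pi_of_empty]
  | succ m ih =>
    rw [← (measurePreserving_insertNth_stdGaussian 0).map_eq,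
      ← (volume_preserving_piFinSuccAbove (fun _ : Fin (m + 1) => ℝ) 0).symm.map_eq]
    exact ((gaussianReal_absolutelyContinuous 0 one_ne_zero).prod ih).map
      (MeasurableEquiv.measurable _)

section Seminorm

variable {n : ℕ} {N : (Fin n → ℝ) → ℝ}

theorem exists_lipschitzWith_of_subadditive (hadd : ∀ x y, N (x + y) ≤ N x + N y)
    (hsmul : ∀ (r : ℝ) (x), N (r • x) = |r| * N x) : ∃ C, LipschitzWith C N := by
  let p : Seminorm ℝ (Fin n → ℝ) := Seminorm.of N hadd hsmul
  have hnn (x) : 0 ≤ N x := apply_nonneg p x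
  have hle (x : Fin n → ℝ) : N x ≤ (∑ i, N (Pi.single i 1)) * ‖x‖ := by
    calc N x = p (∑ i, x i • Pi.single i (1 : ℝ)) := by
          rw [← pi_eq_sum_univ' x]
          rfl
      _ ≤ ∑ i, p (x i • Pi.single i (1 : ℝ)) := Finset.le_sum_of_subadditive p (map_zero p).le (map_add_le_add p) _ _
      _ ≤ ∑ i, N (Pi.single i 1) * ‖x‖ := by
          refine Finset.sum_le_sum fun i _ => ?_
          rw [map_smul_eq_mul, mul_comm]
          exact mul_le_mul_of_nonneg_left (norm_le_pi_norm x i) (hnn _)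
      _ = _ := by rw [Finset.sum_mul]
  refine ⟨⟨∑ i, N (Pi.single i 1), Finset.sum_nonneg fun i _ => hnn _⟩,
    LipschitzWith.of_le_add_mul _ fun x y => ?_⟩
  have := hadd y (x - y)
  rw [add_sub_cancel] at this
  rw [dist_eq_norm]
  exact this.trans (by gcongr; exact hle _)

end Seminorm

section Slices

variable {m : ℕ} {N : (Fin (m + 1) → ℝ) → ℝ} {i : Fin (m + 1)}

theorem insertNth_neg_eq_of_unconditional
    (hunc : ∀ ε : Fin (m + 1) → ℝ, (∀ i, ε i = 1 ∨ ε i = -1) →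
      ∀ x : Fin (m + 1) → ℝ, N (fun i => ε i * x i) = N x) (z : Fin m → ℝ) (u : ℝ) :
    N (i.insertNth (α := fun _ => ℝ) (-u) z) = N (i.insertNth (α := fun _ => ℝ) u z) := by
  rw [← hunc (i.insertNth (α := fun _ => ℝ) (-1) (fun _ => 1))]
  · congr 1
    ext j
    refine i.succAboveCases ?_ (fun j => ?_) j <;> simp
  · intro j
    refine i.succAboveCases ?_ (fun j => ?_) j <;> simp

theorem insertNth_eq_add_smul_single (z : Fin m → ℝ) (s : ℝ) :
    i.insertNth (α := fun _ => ℝ) s z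
      = i.insertNth (α := fun _ => ℝ) 0 z + s • Pi.single i (1 : ℝ) := by
  ext j
  refine i.succAboveCases ?_ (fun j => ?_) j <;> simp

theorem convexOn_insertNth (hadd : ∀ x y, N (x + y) ≤ N x + N y)
    (hsmul : ∀ (r : ℝ) (x), N (r • x) = |r| * N x) (z : Fin m → ℝ) :
    ConvexOn ℝ Set.univ fun s : ℝ => N (i.insertNth (α := fun _ => ℝ) s z) := by
  refine ⟨convex_univ, fun s _ t _ a b ha hb hab => ?_⟩
  have : i.insertNth (α := fun _ => ℝ) (a • s + b • t) z
      = a • i.insertNth (α := fun _ => ℝ) s z + b • i.insertNth (α := fun _ => ℝ) t z := by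
    ext j
    refine i.succAboveCases ?_ (fun j => ?_) j <;> simp [← add_mul, hab]
  simp only [this]
  refine (hadd _ _).trans ?_
  rw [hsmul, hsmul, abs_of_nonneg ha, abs_of_nonneg hb]
  rfl

theorem hasDerivAt_insertNth {z : Fin m → ℝ} {s : ℝ}
    (h : DifferentiableAt ℝ N (i.insertNth (α := fun _ => ℝ) s z)) :
    HasDerivAt (fun s : ℝ => N (i.insertNth (α := fun _ => ℝ) s z))
      (partialDeriv N i (i.insertNth (α := fun _ => ℝ) s z)) s := by
  refine h.hasFDerivAt.comp_hasDerivAt s ?_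
  rw [show (fun s : ℝ => i.insertNth (α := fun _ => ℝ) s z) = _ from
    funext fun s => insertNth_eq_add_smul_single z s]
  simpa using ((hasDerivAt_id s).smul_const (Pi.single i (1 : ℝ))).const_add
    (i.insertNth (α := fun _ => ℝ) 0 z)

end Slices

/-- If a 1-unconditional norm `N` on `ℝⁿ` satisfies the isotropic condition of the
minimal-`M` position, `∫ ∂ᵢN(x) xᵢ dγₙ = E N(G) / n` for all `i`, then
`∫ |∂ᵢ N| dγₙ ≤ √(π/2) E N(G) / n` for every `i`. -/
theorem statement7 (n : ℕ) (hn : 1 ≤ n) (N : (Fin n → ℝ) → ℝ)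
    (hadd : ∀ x y, N (x + y) ≤ N x + N y)
    (hsmul : ∀ (r : ℝ) (x), N (r • x) = |r| * N x)
    (hdef : ∀ x, N x = 0 → x = 0)
    (hunc : ∀ ε : Fin n → ℝ, (∀ i, ε i = 1 ∨ ε i = -1) →
      ∀ x : Fin n → ℝ, N (fun i => ε i * x i) = N x)
    (hiso : ∀ i : Fin n,
      ∫ x, partialDeriv N i x * x i ∂stdGaussian n
        = (∫ x, N x ∂stdGaussian n) / n) :
    ∀ i : Fin n,
      ∫ x, |partialDeriv N i x| ∂stdGaussian n
        ≤ Real.sqrt (π / 2) * (∫ x, N x ∂stdGaussian n) / n := by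
  intro i
  obtain ⟨m, rfl⟩ : ∃ m, n = m + 1 := ⟨n - 1, by omega⟩
  obtain ⟨C, hC⟩ := exists_lipschitzWith_of_subadditive hadd hsmul
  have hdiff : ∀ᵐ x ∂stdGaussian (m + 1), DifferentiableAt ℝ N x :=
    (stdGaussian_absolutelyContinuous _).ae_le hC.ae_differentiableAt
  have hmeas : Measurable (partialDeriv N i) := measurable_fderiv_apply_const ℝ N _
  have hbound (x) : ‖|partialDeriv N i x|‖ ≤ C * ‖(Pi.single i 1 : Fin (m + 1) → ℝ)‖ := by
    rw [norm_abs_eq_norm]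
    exact ((fderiv ℝ N x).le_opNorm _).trans (by gcongr; exact norm_fderiv_le_of_lipschitz ℝ hC)
  have heven := insertNth_neg_eq_of_unconditional (i := i) hunc
  have hconv := convexOn_insertNth (i := i) hadd hsmul
  have hmp := measurePreserving_insertNth_stdGaussian i
  set e := (MeasurableEquiv.piFinSuccAbove (fun _ : Fin (m + 1) => ℝ) i).symm
  have he (p : ℝ × (Fin m → ℝ)) : e p = i.insertNth (α := fun _ => ℝ) p.1 p.2 := rfl
  have hmeas' : Measurable fun p => |partialDeriv N i (e p)| := (hmeas.comp e.measurable).abs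
  have hD : Integrable (fun p : ℝ × (Fin m → ℝ) => |partialDeriv N i (e p)|)
      ((gaussianReal 0 1).prod (stdGaussian m)) :=
    .of_bound hmeas'.aestronglyMeasurable _ (.of_forall fun p => hbound (e p))
  have hDs : Integrable (fun p : ℝ × (Fin m → ℝ) => |partialDeriv N i (e p)| * |p.1|)
      ((gaussianReal 0 1).prod (stdGaussian m)) :=
    (integrable_abs_gaussianReal.comp_fst _).bdd_mul hmeas'.aestronglyMeasurable
      (.of_forall fun p => hbound (e p))
  have hslice : ∀ᵐ z ∂stdGaussian m, ∀ᵐ s ∂gaussianReal 0 1,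
      DifferentiableAt ℝ N (i.insertNth (α := fun _ => ℝ) s z) :=
    Measure.ae_ae_of_ae_prod
      ((Measure.measurePreserving_swap.quasiMeasurePreserving.ae
        (hmp.quasiMeasurePreserving.ae hdiff)))
  have hiso_abs : ∫ p, |partialDeriv N i (e p)| * |p.1| ∂(gaussianReal 0 1).prod (stdGaussian m)
      = ∫ x, partialDeriv N i x * x i ∂stdGaussian (m + 1) := by
    rw [← hmp.integral_comp e.measurableEmbedding]
    refine integral_congr_ae ((hmp.quasiMeasurePreserving.ae hdiff).mono fun p hp => ?_)
    have := (hconv p.2).deriv_mul_self_nonneg_of_even (heven p.2) (hasDerivAt_insertNth hp)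
    simp only [← abs_mul, he, Fin.insertNth_apply_same]
    exact abs_of_nonneg this
  have hassoc : (∫ x, |partialDeriv N i x| ∂stdGaussian (m + 1)) * √(2 / π)
      ≤ (∫ x, N x ∂stdGaussian (m + 1)) / (m + 1 : ℕ) := by
    rw [← hiso i, ← hiso_abs, ← hmp.integral_comp e.measurableEmbedding,
      integral_prod_symm _ hD, integral_prod_symm _ hDs, ← integral_mul_const,
      ← integral_abs_gaussianReal]
    refine integral_mono_ae (hD.integral_prod_right.mul_const _) hDs.integral_prod_right ?_
    filter_upwards [hslice, hD.prod_left_ae, hDs.prod_left_ae] with z hz hDz hDsz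
    refine integral_mul_integral_le_of_ae_monovary hDz integrable_abs_gaussianReal hDsz ?_
    filter_upwards [hz] with s hs
    filter_upwards [hz] with t ht
    rcases lt_trichotomy |s| |t| with hst | hst | hst
    · exact mul_nonneg_of_nonpos_of_nonpos (sub_nonpos.2 ((hconv z).abs_deriv_le_of_even (heven z)
        (hasDerivAt_insertNth ht) (hasDerivAt_insertNth hs) hst)) (sub_nonpos.2 hst.le)
    · simp [hst]
    · exact mul_nonneg (sub_nonneg.2 ((hconv z).abs_deriv_le_of_even (heven z)
        (hasDerivAt_insertNth hs) (hasDerivAt_insertNth ht) hst)) (sub_nonneg.2 hst.le)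
  have hsqrt : √(2 / π) * √(π / 2) = 1 := by
    rw [← Real.sqrt_mul (by positivity), div_mul_div_cancel₀ pi_ne_zero, div_self two_ne_zero,
      Real.sqrt_one]
  have := mul_le_mul_of_nonneg_right hassoc (Real.sqrt_nonneg (π / 2))
  rw [mul_assoc, hsqrt, mul_one] at this
  exact this.trans_eq (by ring)
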